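/- Let m, n > 1 and let R = (r_1, …, r_m), C = (c_1, …, c_n) be positive integer vectors with Σ_i r_i = Σ_j c_j = N, such that not all r_i are equal and not all c_j are equal. For each positive integer k, consider the uniform probability space of all km × kn nonnegative integer matrices with total sum of entries equal to k²N, and let R_k be the event that a matrix has row-sum vector R_k (the cloned row margins) and C_k the event that it has column-sum vector C_k (the cloned column margins). Then there exists γ = γ(R, C) > 1 such that for all sufficiently large k, Pr(R_k ∩ C_k) / (Pr(R_k) · Pr(C_k)) ≥ γ^{k²}; that is, the two events attract exponentially in k² rather than being asymptotically independent. -/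

import Mathlib

/-- A sequence is symmetric about `T / 2` and nonincreasing to the right of `T / 2`. -/
def SymmetricUnimodal (T : ℤ) (f : ℤ → ℕ) : Prop :=
  (∀ z, f (T - z) = f z) ∧ ∀ z, T < 2 * z → f z ≤ f (z - 1)

theorem SymmetricUnimodal.le_of_le {T : ℤ} {f : ℤ → ℕ} (hf : SymmetricUnimodal T f) {x y : ℤ}
    (hT : T ≤ 2 * y) (hxy : y ≤ x) : f x ≤ f y := by
  induction x, hxy using Int.leInduction with
  | base => exact le_rfl
  | succ n hn ih => exact (by simpa using hf.2 (n + 1) (by lia) : f (n + 1) ≤ f n).trans ih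

theorem SymmetricUnimodal.sum_range {T : ℤ} {f : ℤ → ℕ} (hf : SymmetricUnimodal T f) (t : ℕ) :
    SymmetricUnimodal (T + t) fun z => ∑ s ∈ Finset.range (t + 1), f (z - s) := by
  constructor
  · intro z
    dsimp only
    rw [← Finset.sum_range_reflect]
    refine Finset.sum_congr rfl fun s hs => ?_
    rw [← hf.1]
    congr 1
    have := Finset.mem_range.1 hs
    rw [Nat.add_sub_cancel, Nat.cast_sub (by lia)]
    ring
  · intro z hz
    dsimp only
    rw [Finset.sum_range_succ', Finset.sum_range_succ]
    have h : f z ≤ f (z - 1 - t) := by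
      by_cases h : T ≤ 2 * (z - 1 - t)
      · exact hf.le_of_le h (by lia)
      · rw [← hf.1 (z - 1 - t)]
        exact hf.le_of_le (by lia) (by lia)
    refine add_le_add (le_of_eq (Finset.sum_congr rfl fun s _ => ?_)) (by simpa using h)
    congr 1
    push_cast
    ring

theorem symmetricUnimodal_coeff_prod {κ : Type*} (S : Finset κ) (t : κ → ℕ) :
    SymmetricUnimodal (∑ j ∈ S, (t j : ℤ))
      fun z => (∏ j ∈ S, ∑ s ∈ Finset.range (t j + 1),
        (AddMonoidAlgebra.single (s : ℤ) 1 : AddMonoidAlgebra ℕ ℤ)).coeff z := by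
  classical
  induction S using Finset.induction with
  | empty =>
    constructor
    · intro z
      simp only [Finset.sum_empty, Finset.prod_empty, AddMonoidAlgebra.one_def,
        AddMonoidAlgebra.coeff_single, Finsupp.single_apply]
      grind
    · intro z hz
      simp at hz
      simp only [Finset.prod_empty, AddMonoidAlgebra.one_def,
        AddMonoidAlgebra.coeff_single, Finsupp.single_apply]
      grind
  | insert j S hj ih =>
    rw [Finset.sum_insert hj, add_comm]
    convert ih.sum_range (t j) using 2 with z
    rw [Finset.prod_insert hj, mul_comm, Finset.mul_sum]
    simp [-LaurentPolynomial.single_eq_C_mul_T, sub_eq_add_neg, AddMonoidAlgebra.coeff_sum]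

theorem card_filter_sum_eq_coeff {κ : Type*} [Fintype κ] [DecidableEq κ] (t : κ → ℕ) (p : ℕ) :
    ((Fintype.piFinset fun j => Finset.range (t j + 1)).filter fun a => ∑ j, a j = p).card =
      (∏ j, ∑ s ∈ Finset.range (t j + 1),
        (AddMonoidAlgebra.single (s : ℤ) 1 : AddMonoidAlgebra ℕ ℤ)).coeff p := by
  rw [Finset.prod_univ_sum, Finset.card_filter]
  have (x : κ → ℕ) : ∏ j, (AddMonoidAlgebra.single (x j : ℤ) 1 : AddMonoidAlgebra ℕ ℤ) =
      AddMonoidAlgebra.single ((∑ j, x j : ℕ) : ℤ) 1 := by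
    simp [-LaurentPolynomial.single_eq_C_mul_T, AddMonoidAlgebra.prod_single]
  simp only [this]
  simp only [AddMonoidAlgebra.coeff_sum, AddMonoidAlgebra.coeff_single, Finsupp.coe_finsetSum,
    Finset.sum_apply, Finsupp.single_apply, Nat.cast_inj]

theorem card_filter_sum_le {κ : Type*} [Fintype κ] [DecidableEq κ] (t : κ → ℕ) (p : ℕ)
    (h : ∑ j, t j < 2 * (p + 1)) :
    ((Fintype.piFinset fun j => Finset.range (t j + 1)).filter fun a => ∑ j, a j = p + 1).card ≤
    ((Fintype.piFinset fun j => Finset.range (t j + 1)).filter fun a => ∑ j, a j = p).card := by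
  rw [card_filter_sum_eq_coeff, card_filter_sum_eq_coeff]
  have := (symmetricUnimodal_coeff_prod Finset.univ t).2 (p + 1) (by exact_mod_cast h)
  simpa using this

theorem exists_injOn_sum_eq {κ : Type*} [Fintype κ] (t : κ → ℕ) (p : ℕ)
    (h : ∑ j, t j < 2 * (p + 1)) :
    ∃ φ : (κ → ℕ) → κ → ℕ,
      (∀ a, a ≤ t → ∑ j, a j = p + 1 → φ a ≤ t ∧ ∑ j, φ a j = p) ∧
      Set.InjOn φ {a | a ≤ t ∧ ∑ j, a j = p + 1} := by
  classical
  have h1 := card_filter_sum_le t p h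
  obtain ⟨φ, h2, h3⟩ := (Finset.finite_toSet ((Fintype.piFinset fun j =>
    Finset.range (t j + 1)).filter fun a => ∑ j, a j = p + 1)).exists_injOn_of_encard_le
    (t := (((Fintype.piFinset fun j => Finset.range (t j + 1)).filter fun a => ∑ j, a j = p :
      Finset (κ → ℕ)) : Set (κ → ℕ)))
    (by rw [Set.encard_coe_eq_coe_finsetCard, Set.encard_coe_eq_coe_finsetCard]; exact_mod_cast h1)
  refine ⟨φ, fun a ha ha' => ?_, fun a ha b hb => h3 ?_ ?_⟩
  · have := @h2 a (by simpa [Nat.lt_succ_iff, ha', Pi.le_def] using ha)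
    simpa [Nat.lt_succ_iff, Pi.le_def] using this
  · simpa [Nat.lt_succ_iff, Pi.le_def] using ha
  · simpa [Nat.lt_succ_iff, Pi.le_def] using hb

/-- The contingency tables with row sums `R` and column sums `C`. -/
def contingencyTables {ι κ : Type*} [Fintype ι] [Fintype κ] (R : ι → ℕ) (C : κ → ℕ) :
    Set (ι → κ → ℕ) :=
  {D | (∀ i, ∑ j, D i j = R i) ∧ ∀ j, ∑ i, D i j = C j}

section
variable {ι κ : Type*} [Fintype ι] [Fintype κ]

theorem finite_contingencyTables (R : ι → ℕ) (C : κ → ℕ) : (contingencyTables R C).Finite := by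
  classical
  refine (Set.finite_Iic (fun i (_ : κ) => R i)).subset fun D hD i j => ?_
  dsimp only
  rw [← hD.1 i]
  exact Finset.single_le_sum (f := D i) (fun _ _ => Nat.zero_le _) (Finset.mem_univ j)

theorem sum_eq_sum_of_eq_off_pair {M : Type*} [AddCommMonoid M] {i i' : ι} (hi : i ≠ i')
    {f g : ι → M} (h : ∀ x, x ≠ i → x ≠ i' → f x = g x) (hs : f i + f i' = g i + g i') :
    ∑ x, f x = ∑ x, g x := by
  classical
  have h' : i' ∈ Finset.univ.erase i := by simp [hi.symm]
  have key (f : ι → M) :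
      ∑ x, f x = f i + f i' + ∑ x ∈ (Finset.univ.erase i).erase i', f x := by
    rw [← Finset.add_sum_erase _ f (Finset.mem_univ i), ← Finset.add_sum_erase _ f h', add_assoc]
  rw [key f, key g, hs]
  congr 1
  refine Finset.sum_congr rfl fun x hx => ?_
  simp only [Finset.mem_erase] at hx
  exact h x hx.2.1 hx.1

/-- Moving one unit from a larger row sum to a smaller one does not decrease the number of
contingency tables. -/
theorem ncard_contingencyTables_le_update [DecidableEq ι] (R : ι → ℕ) (C : κ → ℕ) {i i' : ι}
    (h : R i' < R i) :
    (contingencyTables R C).ncard ≤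
      (contingencyTables (Function.update (Function.update R i (R i - 1)) i' (R i' + 1)) C).ncard := by
  have hi : i ≠ i' := by rintro rfl; exact lt_irrefl _ h
  obtain ⟨p, hp⟩ : ∃ p, R i = p + 1 := ⟨R i - 1, by lia⟩
  have (t : κ → ℕ) : ∃ φ : (κ → ℕ) → κ → ℕ, ∑ j, t j < 2 * (p + 1) →
      (∀ a, a ≤ t → ∑ j, a j = p + 1 → φ a ≤ t ∧ ∑ j, φ a j = p) ∧
      Set.InjOn φ {a | a ≤ t ∧ ∑ j, a j = p + 1} := by
    by_cases ht : ∑ j, t j < 2 * (p + 1)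
    · obtain ⟨φ, hφ⟩ := exists_injOn_sum_eq t p ht
      exact ⟨φ, fun _ => hφ⟩
    · exact ⟨id, fun h => absurd h ht⟩
  choose φ hφ using this
  let F (D : ι → κ → ℕ) : ι → κ → ℕ := Function.update
    (Function.update D i (φ (D i + D i') (D i))) i' (D i + D i' - φ (D i + D i') (D i))
  have Fi (D) : F D i = φ (D i + D i') (D i) := by simp [F, hi]
  have Fi' (D) : F D i' = D i + D i' - φ (D i + D i') (D i) := by simp [F]
  have Fx (D) (x) (hx : x ≠ i) (hx' : x ≠ i') : F D x = D x := by simp [F, hx, hx']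
  have ht {D} (hD : D ∈ contingencyTables R C) :
      ∑ j, (D i + D i') j = R i + R i' := by
    simp [Finset.sum_add_distrib, hD.1]
  have hlt {D} (hD : D ∈ contingencyTables R C) :
      ∑ j, (D i + D i') j < 2 * (p + 1) := by rw [ht hD]; lia
  have hle (D : ι → κ → ℕ) : D i ≤ D i + D i' := fun j => Nat.le_add_right _ _
  have hF {D} (hD : D ∈ contingencyTables R C) :=
    (hφ _ (hlt hD)).1 (D i) (hle D) ((hD.1 i).trans hp)
  have hadd {D} (hD : D ∈ contingencyTables R C) : F D i + F D i' = D i + D i' := by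
    rw [Fi, Fi', add_tsub_cancel_of_le (hF hD).1]
  refine Set.ncard_le_ncard_of_injOn F (fun D hD => ⟨fun x => ?_, fun j => ?_⟩) ?_
    (finite_contingencyTables _ _)
  · by_cases hx' : x = i'
    · subst hx'
      have h1 : ∑ j, F D i j + ∑ j, F D x j = R i + R x := by
        rw [← ht hD, ← hadd hD, ← Finset.sum_add_distrib]; rfl
      rw [Fi, (hF hD).2] at h1
      simp
      lia
    by_cases hx : x = i
    · subst hx
      rw [Fi, (hF hD).2]
      simp [hi, hp]
    · rw [Fx D x hx hx']
      simp [hx, hx', hD.1]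
  · rw [← hD.2 j]
    exact sum_eq_sum_of_eq_off_pair hi (fun x hx hx' => by rw [Fx D x hx hx'])
      (congrFun (hadd hD) j)
  · intro D hD E hE hDE
    have h1 : D i + D i' = E i + E i' := by rw [← hadd hD, ← hadd hE, hDE]
    have h2 : D i = E i := by
      have h3 := congrFun hDE i
      rw [Fi, Fi, h1] at h3
      exact (hφ _ (hlt hE)).2 ⟨h1 ▸ hle D, (hD.1 i).trans hp⟩ ⟨hle E, (hE.1 i).trans hp⟩ h3
    funext x
    by_cases hx : x = i
    · rw [hx, h2]
    by_cases hx' : x = i'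
    · rw [h2] at h1
      rw [hx', add_left_cancel h1]
    · rw [← Fx D x hx hx', ← Fx E x hx hx', hDE]

/-- Averaging row sums within blocks of rows does not decrease the number of contingency tables. -/
theorem ncard_contingencyTables_le_of_blocks {α : Type*} [DecidableEq α] (β : ι → α) (ρ : α → ℕ)
    (C : κ → ℕ) (R : ι → ℕ)
    (h : ∀ b, ∑ i with β i = b, R i = ∑ i with β i = b, ρ (β i)) :
    (contingencyTables R C).ncard ≤ (contingencyTables (fun i => ρ (β i)) C).ncard := by
  classical
  induction hd : ∑ i, (R i - ρ (β i)) generalizing R with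
  | zero =>
    have hle : ∀ i, R i ≤ ρ (β i) := by
      simpa [Nat.sub_eq_zero_iff_le] using hd
    have : R = fun i => ρ (β i) := by
      funext i
      exact (Finset.sum_eq_sum_iff_of_le fun x _ => hle x).1 (h (β i)) i (by simp)
    rw [← this]
  | succ d ih =>
    obtain ⟨i, hi⟩ : ∃ i, ρ (β i) < R i := by
      by_contra! hcon
      simp [Nat.sub_eq_zero_of_le (hcon _)] at hd
    obtain ⟨i', hb, hi'⟩ : ∃ i', β i' = β i ∧ R i' < ρ (β i') := by
      by_contra! hcon
      exact (Finset.sum_lt_sum (s := Finset.univ.filter fun x => β x = β i)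
        (fun x hx => hcon x (by simpa using hx)) ⟨i, by simp, hi⟩).ne' (h (β i))
    have hlt : R i' < R i := by rw [hb] at hi'; lia
    have hne : i ≠ i' := by rintro rfl; exact lt_irrefl _ hlt
    refine (ncard_contingencyTables_le_update R C hlt).trans (ih _ (fun b => ?_) ?_)
    · rw [← h b, Finset.sum_filter, Finset.sum_filter]
      refine sum_eq_sum_of_eq_off_pair hne (fun x hx hx' => by simp [hx, hx']) ?_
      simp only [Function.update_self, Function.update_of_ne hne, hb]
      split_ifs <;> lia
    · have : ∑ x, (Function.update (Function.update R i (R i - 1)) i' (R i' + 1) x - ρ (β x) +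
          if x = i then 1 else 0) = ∑ x, (R x - ρ (β x)) := by
        refine sum_eq_sum_of_eq_off_pair hne (fun x hx hx' => by simp [hx, hx']) ?_
        simp only [Function.update_self, Function.update_of_ne hne, hne.symm, if_true, if_false]
        lia
      rw [Finset.sum_add_distrib] at this
      simp at this
      lia

theorem ncard_contingencyTables_comm (R : ι → ℕ) (C : κ → ℕ) :
    (contingencyTables R C).ncard = (contingencyTables C R).ncard :=
  Set.ncard_congr (fun D _ j i => D i j) (fun _ hD => ⟨hD.2, hD.1⟩)
    (fun D E _ _ h => by funext i j; exact congrFun (congrFun h j) i)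
    (fun D hD => ⟨fun i j => D j i, ⟨hD.2, hD.1⟩, rfl⟩)

end

theorem sum_filter_fst_eq {α γ M : Type*} [Fintype α] [Fintype γ]
    [AddCommMonoid M] (g : α × γ → M) (b : α) [DecidablePred fun x : α × γ => x.1 = b] :
    ∑ x with x.1 = b, g x = ∑ a, g (b, a) := by
  classical
  rw [Finset.sum_filter, Fintype.sum_prod_type, Finset.sum_eq_single b] <;> simp +contextual

theorem prod_choose_le_card_blocks {α α' : Type*} [Fintype α] [Fintype α'] [DecidableEq α]
    [DecidableEq α'] (k : ℕ) (w : α → α' → ℕ) :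
    ∃ A : Finset (α × Fin k → α' × Fin k → ℕ),
      (∀ D ∈ A, ∀ i j, ∑ a, ∑ b, D (i, a) (j, b) = w i j) ∧
      A.card = ∏ i, ∏ j, Nat.choose (w i j + k ^ 2 - 1) (w i j) := by
  let P : Finset (α × α' → (Fin k × Fin k →₀ ℕ)) := Fintype.piFinset fun x =>
    Finset.finsuppAntidiag Finset.univ (w x.1 x.2)
  refine ⟨P.image fun f x y => f (x.1, y.1) (x.2, y.2), ?_, ?_⟩
  · intro D hD i j
    obtain ⟨f, hf, rfl⟩ := Finset.mem_image.1 hD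
    have := (Finset.mem_finsuppAntidiag.1 (Fintype.mem_piFinset.1 hf (i, j))).1
    rw [← this, ← Fintype.sum_prod_type']
  · rw [Finset.card_image_of_injective]
    · rw [Fintype.card_piFinset, Fintype.prod_prod_type]
      refine Finset.prod_congr rfl fun i _ => Finset.prod_congr rfl fun j _ => ?_
      rw [Finset.card_finsuppAntidiag_nat_eq_choose]
      simp [sq, add_comm]
    · intro f g hfg
      funext x
      ext y
      exact congrFun (congrFun hfg (x.1, y.1)) (x.2, y.2)

/-- A lower bound for the number of contingency tables whose margins are constant on blocks, in
terms of the number of tables with prescribed block sums. -/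
theorem prod_choose_le_ncard_contingencyTables_mul {α α' : Type*} [Fintype α] [Fintype α'] (k : ℕ)
    (w : α → α' → ℕ) (ρ : α → ℕ) (σ : α' → ℕ) (hρ : ∀ i, ∑ j, w i j = k * ρ i)
    (hσ : ∀ j, ∑ i, w i j = k * σ j) :
    ∏ i, ∏ j, Nat.choose (w i j + k ^ 2 - 1) (w i j) ≤
      (contingencyTables (fun x : α × Fin k => ρ x.1) (fun y : α' × Fin k => σ y.1)).ncard *
        ((∑ i, ∑ j, w i j + 1) ^ (Fintype.card α * k) *
          (∑ i, ∑ j, w i j + 1) ^ (Fintype.card α' * k)) := by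
  classical
  obtain ⟨A, hA, hcard⟩ := prod_choose_le_card_blocks k w
  rw [← hcard]
  set W := ∑ i, ∑ j, w i j with hW
  have htot {D} (hD : D ∈ A) : ∑ x, ∑ y, D x y = W := by
    simp_rw [Fintype.sum_prod_type, hW, ← hA D hD]
    refine Finset.sum_congr rfl fun i _ => ?_
    rw [Finset.sum_comm]
  let margins (D : α × Fin k → α' × Fin k → ℕ) : (α × Fin k → ℕ) × (α' × Fin k → ℕ) :=
    (fun x => ∑ y, D x y, fun y => ∑ x, D x y)
  let B : Finset ((α × Fin k → ℕ) × (α' × Fin k → ℕ)) :=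
    (Fintype.piFinset fun _ => Finset.range (W + 1)) ×ˢ
      (Fintype.piFinset fun _ => Finset.range (W + 1))
  have hB : B.card = (W + 1) ^ (Fintype.card α * k) * (W + 1) ^ (Fintype.card α' * k) := by
    simp [B, Finset.card_product, Fintype.card_piFinset]
  rw [← hB]
  refine Finset.card_le_mul_card_image_of_maps_to (f := margins) (fun D hD => ?_) _ ?_
  · simp only [B, margins, Finset.mem_product, Fintype.mem_piFinset, Finset.mem_range,
      Nat.lt_succ_iff]
    rw [← htot hD]
    refine ⟨fun x => Finset.single_le_sum (f := fun x => ∑ y, D x y) (fun _ _ => Nat.zero_le _)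
      (Finset.mem_univ x), fun y => ?_⟩
    rw [Finset.sum_comm]
    exact Finset.single_le_sum (f := fun y => ∑ x, D x y) (fun _ _ => Nat.zero_le _)
      (Finset.mem_univ y)
  · rintro ⟨R, C⟩ -
    rcases (A.filter fun D => margins D = (R, C)).eq_empty_or_nonempty with h0 | ⟨D, hD⟩
    · simp [h0]
    obtain ⟨hDA, hDm⟩ := Finset.mem_filter.1 hD
    have hR (x) : R x = ∑ y, D x y := by exact (congrFun (congrArg Prod.fst hDm) x).symm
    have hC (y) : C y = ∑ x, D x y := by exact (congrFun (congrArg Prod.snd hDm) y).symm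
    calc _ = Set.ncard (A.filter fun D => margins D = (R, C) :
            Set (α × Fin k → α' × Fin k → ℕ)) := by
          rw [Set.ncard_coe_finset]
      _ ≤ (contingencyTables R C).ncard := by
          refine Set.ncard_le_ncard (fun E hE => ?_) (finite_contingencyTables _ _)
          have hEm := (Finset.mem_filter.1 (Finset.mem_coe.1 hE)).2
          exact ⟨fun x => congrFun (congrArg Prod.fst hEm) x,
            fun y => congrFun (congrArg Prod.snd hEm) y⟩
      _ ≤ (contingencyTables (fun x : α × Fin k => ρ x.1) C).ncard := by
          refine ncard_contingencyTables_le_of_blocks Prod.fst ρ C R fun b => ?_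
          rw [sum_filter_fst_eq, sum_filter_fst_eq]
          simp only [hR, Finset.sum_const, Finset.card_univ, Fintype.card_fin,
            smul_eq_mul, ← hρ b, ← hA D hDA, Fintype.sum_prod_type]
          exact Finset.sum_comm
      _ = (contingencyTables C (fun x : α × Fin k => ρ x.1)).ncard :=
          ncard_contingencyTables_comm _ _
      _ ≤ (contingencyTables (fun y : α' × Fin k => σ y.1) (fun x : α × Fin k => ρ x.1)).ncard := by
          refine ncard_contingencyTables_le_of_blocks Prod.fst σ _ C fun b => ?_
          rw [sum_filter_fst_eq, sum_filter_fst_eq]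
          simp only [hC, Finset.sum_const, Finset.card_univ, Fintype.card_fin,
            smul_eq_mul, ← hσ b, ← hA D hDA, Fintype.sum_prod_type]
          rw [Finset.sum_comm]
          exact Finset.sum_congr rfl fun _ _ => Finset.sum_comm
      _ = _ := ncard_contingencyTables_comm _ _

/-- Any two nonnegative margins with the same total admit a contingency table. -/
theorem contingencyTables_nonempty {ι κ : Type*} [Fintype ι] [Fintype κ] (R : ι → ℕ) (C : κ → ℕ)
    (h : ∑ i, R i = ∑ j, C j) : (contingencyTables R C).Nonempty := by
  classical
  have e : (Σ i, Fin (R i)) ≃ Σ j, Fin (C j) := Fintype.equivOfCardEq (by simpa using h)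
  refine ⟨fun i j => (Finset.univ.filter fun x : Fin (R i) => (e ⟨i, x⟩).1 = j).card,
    fun i => ?_, fun j => ?_⟩
  · dsimp only
    rw [← Finset.card_eq_sum_card_fiberwise (f := fun x => (e ⟨i, x⟩).1)
      (fun _ _ => Finset.mem_coe.2 (Finset.mem_univ _))]
    simp
  · simp only [Finset.card_filter]
    rw [← Fintype.sum_sigma' (fun i (x : Fin (R i)) => if (e ⟨i, x⟩).1 = j then 1 else 0)]
    rw [e.sum_comp (fun y => if y.1 = j then 1 else 0)]
    rw [Fintype.sum_sigma, Finset.sum_eq_single j] <;> simp +contextual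

theorem card_cloned_eq_ncard (m n k : ℕ) (ρ : Fin m → ℕ) (σ : Fin n → ℕ) :
    Nat.card {D : Matrix (Fin (k * m)) (Fin (k * n)) ℕ //
          (∀ i, ∑ j, D i j = ρ ⟨i.val / k, Nat.div_lt_of_lt_mul i.isLt⟩) ∧
          (∀ j, ∑ i, D i j = σ ⟨j.val / k, Nat.div_lt_of_lt_mul j.isLt⟩)} =
      (contingencyTables (fun x : Fin m × Fin k => ρ x.1) (fun y : Fin n × Fin k => σ y.1)).ncard := by
  have he (m : ℕ) : ∃ e : Fin m × Fin k ≃ Fin (k * m), ∀ x, (e x).val / k = x.1.val := by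
    refine ⟨finProdFinEquiv.trans (finCongr (mul_comm m k)), fun x => ?_⟩
    have : 0 < k := Fin.pos x.2
    simp [Nat.add_mul_div_left _ _ this]
  obtain ⟨e, he₁⟩ := he m
  obtain ⟨e', he₂⟩ := he n
  refine Nat.card_congr
    ((Equiv.arrowCongr e.symm (Equiv.arrowCongr e'.symm (Equiv.refl ℕ))).subtypeEquiv fun D => ?_)
  refine and_congr ?_ ?_
  · rw [← e.forall_congr_right]
    refine forall_congr' fun x => ?_
    rw [← e'.sum_comp]
    simp [he₁]
  · rw [← e'.forall_congr_right]
    refine forall_congr' fun x => ?_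
    rw [← e.sum_comp]
    simp [he₂]

theorem sub_le_log_factorial (n : ℕ) : n * Real.log n - n ≤ Real.log n.factorial := by
  induction n with
  | zero => simp
  | succ n ih =>
    have h : Real.log (n + 1) - Real.log n ≤ 1 / n ∨ n = 0 := by
      rcases Nat.eq_zero_or_pos n with h | h
      · exact Or.inr h
      left
      have hn : (0 : ℝ) < n := by exact_mod_cast h
      rw [← Real.log_div (by positivity) hn.ne']
      refine (Real.log_le_sub_one_of_pos (by positivity)).trans (le_of_eq ?_)
      field_simp
      ring
    have h' : n * (Real.log (n + 1) - Real.log n) ≤ 1 := by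
      rcases h with h | h
      · refine (mul_le_mul_of_nonneg_left h (Nat.cast_nonneg n)).trans ?_
        rw [mul_one_div]
        exact div_self_le_one _
      · simp [h]
    rw [Nat.factorial_succ, Nat.cast_mul, Real.log_mul (by positivity) (by positivity)]
    push_cast
    linarith

theorem log_factorial_le (n : ℕ) :
    Real.log n.factorial ≤ n * Real.log n - n + 1 + Real.log n := by
  induction n with
  | zero => simp
  | succ n ih =>
    rcases Nat.eq_zero_or_pos n with rfl | h
    · simp
    have hn : (0 : ℝ) < n := by exact_mod_cast h
    have h' : 1 ≤ (n + 1) * (Real.log (n + 1) - Real.log n) := by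
      have := Real.one_sub_inv_le_log_of_pos (show (0 : ℝ) < (n + 1) / n by positivity)
      rw [Real.log_div (by positivity) hn.ne'] at this
      refine le_trans (le_of_eq ?_) (mul_le_mul_of_nonneg_left this (by positivity))
      field_simp
      ring
    rw [Nat.factorial_succ, Nat.cast_mul, Real.log_mul (by positivity) (by positivity)]
    push_cast
    linarith

/-- The entropy of the geometric distribution with mean `x`. -/
noncomputable def geometricEntropy (x : ℝ) : ℝ := (x + 1) * Real.log (x + 1) - x * Real.log x

theorem continuous_geometricEntropy : Continuous geometricEntropy := by
  unfold geometricEntropy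
  exact (Real.continuous_mul_log.comp (continuous_id.add continuous_const)).sub
    Real.continuous_mul_log

theorem mul_geometricEntropy_div {a b : ℝ} (ha : 0 ≤ a) (hb : 0 < b) :
    b * geometricEntropy (a / b) = (a + b) * Real.log (a + b) - a * Real.log a - b * Real.log b := by
  unfold geometricEntropy
  rw [show a / b + 1 = (a + b) / b by field_simp, Real.log_div (by positivity) hb.ne']
  rcases ha.eq_or_lt with rfl | ha
  · simp
  · rw [Real.log_div ha.ne' hb.ne']
    field_simp
    ring

theorem log_choose_le (a : ℕ) {b : ℕ} (hb : 0 < b) :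
    Real.log (Nat.choose (a + b - 1) (b - 1)) ≤ b * geometricEntropy (a / b) := by
  have hb' : (0 : ℝ) < b := by exact_mod_cast hb
  have self_pow_pos (n : ℕ) : (0 : ℝ) < (n : ℝ) ^ n := by
    rcases Nat.eq_zero_or_pos n with rfl | h
    · simp
    · positivity
  rw [mul_geometricEntropy_div (Nat.cast_nonneg a) hb']
  have h1 : Nat.choose (a + b - 1) (b - 1) ≤ Nat.choose (a + b) a := by
    rw [Nat.choose_symm_of_eq_add (show a + b - 1 = (b - 1) + a by lia)]
    exact Nat.choose_le_choose _ (by lia)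
  have h2 : (a : ℝ) ^ a * (b : ℝ) ^ b * Nat.choose (a + b) a ≤ ((a : ℝ) + b) ^ (a + b) := by
    rw [add_pow]
    refine le_trans (le_of_eq ?_) (Finset.single_le_sum
      (f := fun x => (a : ℝ) ^ x * (b : ℝ) ^ (a + b - x) * Nat.choose (a + b) x)
      (fun _ _ => by positivity) (Finset.mem_range.2 (show a < a + b + 1 by lia)))
    simp
  have h0 : 0 < Nat.choose (a + b - 1) (b - 1) := Nat.choose_pos (by lia)
  have h3 := Real.log_le_log (by have := self_pow_pos a; positivity)
    ((mul_le_mul_of_nonneg_left (Nat.cast_le.2 h1) (by positivity)).trans h2)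
  rw [Real.log_mul (mul_pos (self_pow_pos a) (self_pow_pos b)).ne' (by positivity),
    Real.log_mul (self_pow_pos a).ne' (self_pow_pos b).ne', Real.log_pow, Real.log_pow,
    Real.log_pow] at h3
  push_cast at h3
  linarith

theorem le_log_choose (a : ℕ) {b : ℕ} (hb : 0 < b) :
    b * geometricEntropy (a / b) - (2 + 3 * Real.log (a + b + 1)) ≤
      Real.log (Nat.choose (a + b - 1) (b - 1)) := by
  have hb' : (0 : ℝ) < b := by exact_mod_cast hb
  rw [mul_geometricEntropy_div (Nat.cast_nonneg a) hb']
  obtain ⟨d, rfl⟩ : ∃ d, b = d + 1 := ⟨b - 1, by lia⟩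
  have h1 := Nat.add_choose_mul_factorial_mul_factorial a (d + 1)
  rw [← Nat.choose_symm_add] at h1
  have h2 : Nat.choose (a + (d + 1)) a ≤ (a + (d + 1)) * Nat.choose (a + d) d := by
    rw [Nat.choose_symm_add, ← add_assoc, Nat.add_one_mul_choose_eq]
    exact Nat.le_mul_of_pos_right _ (by lia)
  have h0 : 0 < Nat.choose (a + d) d := Nat.choose_pos (by lia)
  have h0' : 0 < Nat.choose (a + (d + 1)) a := Nat.choose_pos (by lia)
  have h3 := Real.log_le_log (by exact_mod_cast h0') (Nat.cast_le (α := ℝ).2 h2)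
  have h4 := congrArg (fun x : ℕ => Real.log x) h1
  push_cast at h3 h4
  rw [Real.log_mul (by positivity) (by positivity)] at h3
  rw [Real.log_mul (by positivity) (by positivity), Real.log_mul (by positivity)
    (by positivity)] at h4
  have h5 := sub_le_log_factorial (a + (d + 1))
  have h6 := log_factorial_le a
  have h7 := log_factorial_le (d + 1)
  have h8 : Real.log a ≤ Real.log (a + (d + 1) + 1) := by
    rcases Nat.eq_zero_or_pos a with rfl | ha
    · simpa using Real.log_nonneg (by linarith)
    · exact Real.log_le_log (by positivity) (by linarith)
  have h9 : Real.log (d + 1) ≤ Real.log (a + (d + 1) + 1) :=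
    Real.log_le_log (by positivity) (by linarith [(Nat.cast_nonneg a : (0 : ℝ) ≤ a)])
  have h10 : Real.log (a + (d + 1)) ≤ Real.log (a + (d + 1) + 1) :=
    Real.log_le_log (by positivity) (by linarith)
  rw [show a + (d + 1) - 1 = a + d by lia, show d + 1 - 1 = d by lia]
  push_cast at h5 h7 ⊢
  linarith

theorem sum_sq_div_gt {κ : Type*} [Fintype κ] {y : κ → ℝ} (hy : ∀ j, 0 < y j)
    (hsum : ∑ j, y j = Fintype.card κ) (hne : ∃ j, y j ≠ 1) {u : ℝ} (hu : 0 < u) :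
    Fintype.card κ * (1 / (1 + u)) < ∑ j, y j ^ 2 / (1 + u * y j) := by
  have key (j) : y j ^ 2 / (1 + u * y j) = 1 / (1 + u) + (y j - 1) * ((2 + u) / (1 + u) ^ 2) +
      (y j - 1) ^ 2 / ((1 + u * y j) * (1 + u) ^ 2) := by
    have := hy j
    field_simp
    ring
  obtain ⟨j, hj⟩ := hne
  have hpos : 0 < ∑ j, (y j - 1) ^ 2 / ((1 + u * y j) * (1 + u) ^ 2) := by
    refine Finset.sum_pos' (fun i _ => ?_) ⟨j, Finset.mem_univ j, ?_⟩
    · have := hy i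
      positivity
    · have := hy j
      have := sub_ne_zero.2 hj
      positivity
  simp_rw [key, Finset.sum_add_distrib, ← Finset.sum_mul, Finset.sum_sub_distrib, hsum]
  simpa using hpos

theorem hasDerivAt_mul_log_one_add {y u : ℝ} (h : 0 < 1 + u * y) :
    HasDerivAt (fun u => (1 + u * y) * Real.log (1 + u * y)) (y * (Real.log (1 + u * y) + 1)) u := by
  have h1 : HasDerivAt (fun u => 1 + u * y) y u := by
    simpa using ((hasDerivAt_id u).mul_const y).const_add 1
  refine (h1.fun_mul (h1.log h.ne')).congr_deriv ?_
  rw [mul_div_cancel₀ _ h.ne']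
  ring

/-- The convexity gap on which the entropy inequality for product tables rests. -/
theorem strictConvexOn_sum_mul_log_sub {κ : Type*} [Fintype κ] {y : κ → ℝ} (hy : ∀ j, 0 < y j)
    (hsum : ∑ j, y j = Fintype.card κ) (hne : ∃ j, y j ≠ 1) :
    StrictConvexOn ℝ (Set.Ioi 0) fun u => ∑ j, (1 + u * y j) * Real.log (1 + u * y j) -
      Fintype.card κ * ((1 + u) * Real.log (1 + u)) := by
  have h1 {u : ℝ} (hu : 0 < u) : HasDerivAt (fun u => ∑ j, (1 + u * y j) * Real.log (1 + u * y j) -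
      Fintype.card κ * ((1 + u) * Real.log (1 + u)))
      (∑ j, y j * (Real.log (1 + u * y j) + 1) - Fintype.card κ * (Real.log (1 + u) + 1)) u := by
    refine HasDerivAt.sub (HasDerivAt.fun_sum fun j _ => ?_) (HasDerivAt.const_mul _ ?_)
    · have := hy j
      exact hasDerivAt_mul_log_one_add (by positivity)
    · simpa using hasDerivAt_mul_log_one_add (y := 1) (u := u) (by linarith)
  have h2 {u : ℝ} (hu : 0 < u) : HasDerivAt
      (fun u => ∑ j, y j * (Real.log (1 + u * y j) + 1) - Fintype.card κ * (Real.log (1 + u) + 1))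
      (∑ j, y j ^ 2 / (1 + u * y j) - Fintype.card κ * (1 / (1 + u))) u := by
    have hlog {z : ℝ} (hz : 0 < z) : HasDerivAt (fun u => Real.log (1 + u * z) + 1)
        (z / (1 + u * z)) u :=
      ((by simpa using ((hasDerivAt_id u).mul_const z).const_add 1 :
        HasDerivAt (fun u => 1 + u * z) z u).log (by positivity)).add_const 1
    refine HasDerivAt.sub (HasDerivAt.fun_sum fun j _ => ?_) (HasDerivAt.const_mul _ ?_)
    · rw [sq, mul_div_assoc]
      exact (hlog (hy j)).const_mul _
    · simpa using hlog one_pos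
  refine strictConvexOn_of_deriv2_pos' (convex_Ioi 0)
    (fun u hu => (h1 hu).continuousAt.continuousWithinAt) fun u hu => ?_
  have h3 := (h2 hu).congr_of_eventuallyEq (f₁ := deriv _)
    (Filter.eventuallyEq_of_mem (Ioi_mem_nhds hu) fun v hv => (h1 hv).deriv)
  rw [Function.iterate_succ, Function.iterate_one, Function.comp_apply, h3.deriv]
  exact sub_pos.2 (sum_sq_div_gt hy hsum hne hu)

/-- The product table has larger total entropy than independence of the margins predicts. -/
theorem geometricEntropy_product_gt {ι κ : Type*} [Fintype ι] [Fintype κ] {p : ι → ℝ} {q : κ → ℝ}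
    {S : ℝ} (hp : ∀ i, 0 < p i) (hq : ∀ j, 0 < q j) (hpS : ∑ i, p i = S) (hqS : ∑ j, q j = S)
    (hpne : ¬ ∀ i i', p i = p i') (hqne : ¬ ∀ j j', q j = q j') :
    Fintype.card κ * ∑ i, geometricEntropy (p i / Fintype.card κ) +
        Fintype.card ι * ∑ j, geometricEntropy (q j / Fintype.card ι) <
      ∑ i, ∑ j, geometricEntropy (p i * q j / S) +
        Fintype.card ι * Fintype.card κ *
          geometricEntropy (S / (Fintype.card ι * Fintype.card κ)) := by
  push Not at hpne hqne
  obtain ⟨i₀, i₁, hi⟩ := hpne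
  obtain ⟨j₀, j₁, hj⟩ := hqne
  have hm : (0 : ℝ) < Fintype.card ι := by exact_mod_cast Fintype.card_pos_iff.2 ⟨i₀⟩
  have hn : (0 : ℝ) < Fintype.card κ := by exact_mod_cast Fintype.card_pos_iff.2 ⟨j₀⟩
  have hS : 0 < S := hpS ▸ Finset.sum_pos (fun i _ => hp i) ⟨i₀, Finset.mem_univ _⟩
  set m : ℝ := (Fintype.card ι : ℝ) with hm_def
  set n : ℝ := (Fintype.card κ : ℝ) with hn_def
  have hconv := strictConvexOn_sum_mul_log_sub (y := fun j => n * q j / S)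
    (fun j => by have := hq j; positivity)
    (by rw [← Finset.sum_div, ← Finset.mul_sum, hqS, mul_div_cancel_right₀ _ hS.ne'])
    (by
      by_contra! h
      refine hj ?_
      have h0 := (h j₀).trans (h j₁).symm
      field_simp at h0
      exact h0)
  have hJ := hconv.map_sum_lt (t := Finset.univ) (w := fun _ : ι => 1 / m) (p := fun i => p i / n)
    (fun _ _ => by positivity) (by simp [hm_def, (Fintype.card_pos_iff.2 ⟨i₀⟩).ne'])
    (fun i _ => by have := hp i; simp only [Set.mem_Ioi]; positivity)
    ⟨i₀, Finset.mem_univ _, i₁, Finset.mem_univ _, fun h => hi (by field_simp at h; exact h)⟩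
  simp only [smul_eq_mul, ← Finset.mul_sum, ← Finset.sum_div, hpS, ← hn_def] at hJ
  have hψ (x : ℝ) : geometricEntropy x = (1 + x) * Real.log (1 + x) - x * Real.log x := by
    rw [geometricEntropy, add_comm x 1]
  have e1 (j) : S / (m * n) * (n * q j / S) = q j / m := by field_simp
  have e2 (i j) : p i / n * (n * q j / S) = p i * q j / S := by field_simp
  have e3 : 1 / m * (S / n) = S / (m * n) := by field_simp
  simp only [e1, e2, e3, Finset.sum_sub_distrib, ← Finset.mul_sum] at hJ
  rw [one_div, lt_inv_mul_iff₀ hm] at hJ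
  have l1 : n * ∑ i, p i / n * Real.log (p i / n) =
      ∑ i, p i * Real.log (p i) - S * Real.log n := by
    rw [← hpS, Finset.mul_sum, Finset.sum_mul, ← Finset.sum_sub_distrib]
    refine Finset.sum_congr rfl fun i _ => ?_
    rw [Real.log_div (hp i).ne' hn.ne']
    field_simp
  have l2 : m * ∑ j, q j / m * Real.log (q j / m) =
      ∑ j, q j * Real.log (q j) - S * Real.log m := by
    rw [← hqS, Finset.mul_sum, Finset.sum_mul, ← Finset.sum_sub_distrib]
    refine Finset.sum_congr rfl fun j _ => ?_
    rw [Real.log_div (hq j).ne' hm.ne']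
    field_simp
  have l3 : ∑ i, ∑ j, p i * q j / S * Real.log (p i * q j / S) =
      ∑ i, p i * Real.log (p i) + ∑ j, q j * Real.log (q j) - S * Real.log S := by
    have key (i j) : p i * q j / S * Real.log (p i * q j / S) =
        (p i * Real.log (p i)) * (q j / S) + (p i / S) * (q j * Real.log (q j)) -
          p i * (q j / S * Real.log S) := by
      rw [Real.log_div (mul_pos (hp i) (hq j)).ne' hS.ne', Real.log_mul (hp i).ne' (hq j).ne']
      field_simp
    simp_rw [key, Finset.sum_sub_distrib, Finset.sum_add_distrib, ← Finset.mul_sum,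
      ← Finset.sum_mul, ← Finset.sum_div, hpS, hqS, div_self hS.ne', mul_one, one_mul]
  have l4 : m * n * (S / (m * n) * Real.log (S / (m * n))) =
      S * Real.log S - S * Real.log m - S * Real.log n := by
    rw [Real.log_div hS.ne' (by positivity), Real.log_mul hm.ne' hn.ne']
    field_simp
    ring
  simp only [hψ, Finset.sum_sub_distrib, mul_sub]
  linarith

open Filter Topology in
theorem tendsto_log_sq_mul_add_one_div (Q : ℕ) :
    Tendsto (fun k : ℕ => Real.log ((k : ℝ) ^ 2 * Q + 1) / k) atTop (𝓝 0) := by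
  have h1 : Tendsto (fun k : ℕ => Real.log k / k) atTop (𝓝 0) :=
    Real.isLittleO_log_id_atTop.tendsto_div_nhds_zero.comp tendsto_natCast_atTop_atTop
  have h2 : Tendsto (fun k : ℕ => Real.log (Q + 1) / k + 2 * (Real.log k / k)) atTop (𝓝 0) := by
    simpa using (tendsto_const_div_atTop_nhds_zero_nat (Real.log (Q + 1))).add (h1.const_mul 2)
  refine squeeze_zero' (Eventually.of_forall fun k => ?_) ?_ h2
  · exact div_nonneg (Real.log_nonneg (by linarith [show (0 : ℝ) ≤ (k : ℝ) ^ 2 * Q by positivity]))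
      (Nat.cast_nonneg k)
  · filter_upwards [eventually_ge_atTop 1] with k hk
    have hk' : (1 : ℝ) ≤ k := by exact_mod_cast hk
    rw [← mul_div_assoc, ← add_div]
    gcongr
    have : 2 * Real.log k = Real.log ((k : ℝ) ^ 2) := by simp
    rw [this, ← Real.log_mul (by positivity) (by positivity)]
    refine Real.log_le_log (by positivity) ?_
    nlinarith

open Filter Topology in
theorem tendsto_error_div_sq (A M Q : ℕ) :
    Tendsto (fun k : ℕ => ((A : ℝ) * (2 + 3 * Real.log ((k : ℝ) ^ 2 * Q + 1)) +
      k * M * Real.log ((k : ℝ) ^ 2 * Q + 1)) / (k : ℝ) ^ 2) atTop (𝓝 0) := by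
  have hL := tendsto_log_sq_mul_add_one_div Q
  have h0 := tendsto_const_div_atTop_nhds_zero_nat (1 : ℝ)
  have h : Tendsto (fun k : ℕ => (A : ℝ) * 2 * (1 / k * (1 / k)) +
      (A * 3 * (1 / k) + M) * (Real.log ((k : ℝ) ^ 2 * Q + 1) / k)) atTop (𝓝 0) := by
    simpa using ((h0.mul h0).const_mul ((A : ℝ) * 2)).add
      (((h0.const_mul ((A : ℝ) * 3)).add_const (M : ℝ)).mul hL)
  refine h.congr fun k => ?_
  rcases Nat.eq_zero_or_pos k with rfl | hk
  · simp
  · field_simp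
    ring

open Filter Topology in
theorem tendsto_rounding_div_sq {N : ℕ} (hN : 0 < N) (z p : ℕ) :
    Tendsto (fun k : ℕ => ((k ^ 2 / N * z + k ^ 2 % N * p : ℕ) : ℝ) / (k : ℝ) ^ 2) atTop
      (𝓝 (z / N)) := by
  have h0 : Tendsto (fun k : ℕ => ((k ^ 2 % N : ℕ) : ℝ) / (k : ℝ) ^ 2) atTop (𝓝 0) := by
    have h1 : Tendsto (fun k : ℕ => (N : ℝ) / (k : ℝ) ^ 2) atTop (𝓝 0) :=
      Tendsto.const_div_atTop
        ((tendsto_pow_atTop two_ne_zero).comp tendsto_natCast_atTop_atTop) _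
    refine squeeze_zero (fun k => by positivity) (fun k => ?_) h1
    gcongr
    exact (Nat.mod_lt _ hN).le
  have h : Tendsto (fun k : ℕ => (z / N : ℝ) +
      ((k ^ 2 % N : ℕ) : ℝ) / (k : ℝ) ^ 2 * (p - z / N)) atTop (𝓝 (z / N)) := by
    simpa using (h0.mul_const (p - z / N : ℝ)).const_add (z / N : ℝ)
  refine h.congr' ?_
  filter_upwards [eventually_ge_atTop 1] with k hk
  have hN' : (0 : ℝ) < N := by exact_mod_cast hN
  have hk' : (0 : ℝ) < k := by exact_mod_cast hk
  have hdm : (N : ℝ) * ((k ^ 2 / N : ℕ) : ℝ) + ((k ^ 2 % N : ℕ) : ℝ) = (k : ℝ) ^ 2 := by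
    exact_mod_cast Nat.div_add_mod (k ^ 2) N
  rw [Nat.cast_add, Nat.cast_mul, Nat.cast_mul]
  generalize ((k ^ 2 / N : ℕ) : ℝ) = q at *
  generalize ((k ^ 2 % N : ℕ) : ℝ) = ρ at *
  rw [← hdm]
  have : N * q + ρ ≠ 0 := by rw [hdm]; positivity
  field_simp
  ring

/-- A logarithmic lower bound for the number of tables with cloned margins, in terms of any table
of block sums. -/
theorem le_log_ncard_contingencyTables {m n k N : ℕ} (hk : 0 < k) (w : Fin m → Fin n → ℕ)
    (r : Fin m → ℕ) (c : Fin n → ℕ) (hr : ∀ i, ∑ j, w i j = k ^ 2 * r i)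
    (hc : ∀ j, ∑ i, w i j = k ^ 2 * c j) (hrN : ∑ i, r i = N) :
    0 < (contingencyTables (fun x : Fin m × Fin k => k * r x.1)
        (fun y : Fin n × Fin k => k * c y.1)).ncard ∧
    (k : ℝ) ^ 2 * ∑ i, ∑ j, geometricEntropy (w i j / (k : ℝ) ^ 2) -
        (m * n * (2 + 3 * Real.log ((k : ℝ) ^ 2 * (N + 1 : ℕ) + 1)) +
          k * (m + n : ℕ) * Real.log ((k : ℝ) ^ 2 * (N + 1 : ℕ) + 1)) ≤
      Real.log (contingencyTables (fun x : Fin m × Fin k => k * r x.1)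
        (fun y : Fin n × Fin k => k * c y.1)).ncard := by
  have hW : ∑ i, ∑ j, w i j = k ^ 2 * N := by
    simp_rw [hr, ← Finset.mul_sum, hrN]
  have hle (i j) : w i j ≤ k ^ 2 * N := by
    rw [← hW]
    exact (Finset.single_le_sum (f := w i) (fun _ _ => Nat.zero_le _) (Finset.mem_univ j)).trans
      (Finset.single_le_sum (f := fun i => ∑ j, w i j) (fun _ _ => Nat.zero_le _)
        (Finset.mem_univ i))
  have h1 := prod_choose_le_ncard_contingencyTables_mul k w (fun i => k * r i) (fun j => k * c j)
    (fun i => by rw [hr]; ring) (fun j => by rw [hc]; ring)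
  set T := (contingencyTables (fun x : Fin m × Fin k => k * r x.1)
        (fun y : Fin n × Fin k => k * c y.1)).ncard with hT
  have hk2 : 0 < k ^ 2 := by positivity
  have hpos (i j) : 0 < Nat.choose (w i j + k ^ 2 - 1) (w i j) := Nat.choose_pos (by lia)
  have hprod : 0 < ∏ i, ∏ j, Nat.choose (w i j + k ^ 2 - 1) (w i j) :=
    Finset.prod_pos fun i _ => Finset.prod_pos fun j _ => hpos i j
  have hTpos : 0 < T := Nat.pos_of_mul_pos_right (hprod.trans_le h1)
  refine ⟨hTpos, ?_⟩
  rw [hW, Fintype.card_fin, Fintype.card_fin, ← pow_add] at h1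
  have h2 := Real.log_le_log (by exact_mod_cast hprod) (Nat.cast_le (α := ℝ).2 h1)
  push_cast at h2
  rw [Real.log_mul (by positivity) (by positivity), Real.log_pow, Real.log_prod fun i _ =>
    Finset.prod_ne_zero_iff.2 fun j _ => (by exact_mod_cast (hpos i j).ne')] at h2
  simp_rw [Real.log_prod fun j (_ : j ∈ Finset.univ) => (Nat.cast_ne_zero (R := ℝ)).2
    (hpos _ j).ne'] at h2
  have h3 (i j) : (k : ℝ) ^ 2 * geometricEntropy (w i j / (k : ℝ) ^ 2) -
      (2 + 3 * Real.log ((k : ℝ) ^ 2 * (N + 1 : ℕ) + 1)) ≤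
      Real.log (Nat.choose (w i j + k ^ 2 - 1) (w i j)) := by
    have h4 := le_log_choose (w i j) hk2
    rw [Nat.choose_symm_of_eq_add (show w i j + k ^ 2 - 1 = (k ^ 2 - 1) + w i j by lia)] at h4
    have h5 : Real.log ((w i j : ℝ) + (k ^ 2 : ℕ) + 1) ≤
        Real.log ((k : ℝ) ^ 2 * (N + 1 : ℕ) + 1) := by
      refine Real.log_le_log (by positivity) ?_
      have : (w i j : ℝ) ≤ k ^ 2 * N := by exact_mod_cast hle i j
      push_cast
      linarith
    push_cast at h4 h5 ⊢
    linarith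
  have h6 := Finset.sum_le_sum fun i (_ : i ∈ Finset.univ) =>
    Finset.sum_le_sum fun j (_ : j ∈ Finset.univ) => h3 i j
  simp only [Finset.sum_sub_distrib, ← Finset.mul_sum, Finset.sum_const, Finset.card_univ,
    Fintype.card_fin, nsmul_eq_mul] at h6
  have h7 : Real.log ((k : ℝ) ^ 2 * N + 1) ≤ Real.log ((k : ℝ) ^ 2 * (N + 1 : ℕ) + 1) := by
    refine Real.log_le_log (by positivity) ?_
    push_cast
    linarith [sq_nonneg (k : ℝ)]
  have h8 := mul_le_mul_of_nonneg_left h7 (show (0 : ℝ) ≤ k * (m + n : ℕ) by positivity)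
  push_cast at h2 h6 h8 ⊢
  linarith

theorem log_prod_choose_le {ι : Type*} [Fintype ι] (a : ι → ℕ) {k d : ℕ} (hk : 0 < k)
    (hd : 0 < d) :
    Real.log (∏ i, (Nat.choose (k * a i + k * d - 1) (k * d - 1) : ℝ) ^ k) ≤
      (k : ℝ) ^ 2 * (d * ∑ i, geometricEntropy (a i / d)) := by
  have hkd : 0 < k * d := Nat.mul_pos hk hd
  have hpos (i) : (0 : ℝ) < Nat.choose (k * a i + k * d - 1) (k * d - 1) := by
    exact_mod_cast Nat.choose_pos (by lia)
  rw [Real.log_prod fun i _ => (pow_pos (hpos i) k).ne', Finset.mul_sum, Finset.mul_sum]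
  refine Finset.sum_le_sum fun i _ => ?_
  have h := log_choose_le (k * a i) hkd
  push_cast at h
  rw [mul_div_mul_left _ _ (by positivity)] at h
  rw [Real.log_pow]
  calc _ ≤ (k : ℝ) * (k * d * geometricEntropy (a i / d)) :=
        mul_le_mul_of_nonneg_left h (Nat.cast_nonneg k)
    _ = _ := by ring

/-- If not all row sums are equal and not all column sums are equal,
then for the cloned margins `(R_k, C_k)` the events "row sums are `R_k`" and "column
sums are `C_k`" in the uniform probability space of `km × kn` nonnegative integer
matrices with total entry sum `k²N` attract exponentially in `k²`:
`Pr(R_k ∩ C_k) / (Pr(R_k) Pr(C_k)) ≥ γ^{k²}` for some `γ > 1` and all large `k`.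
Here `Pr(R_k ∩ C_k) = #(R_k, C_k)/B`,
`Pr(R_k) = B⁻¹ ∏_i binom(k r_i + kn − 1, kn − 1)^k`,
`Pr(C_k) = B⁻¹ ∏_j binom(k c_j + km − 1, km − 1)^k`, with
`B = binom(k²N + k²mn − 1, k²mn − 1)`. -/
theorem cloned_margins_attraction
    (m n N : ℕ) (hm : 1 < m) (hn : 1 < n)
    (r : Fin m → ℕ) (c : Fin n → ℕ)
    (hr : ∀ i, 0 < r i) (hc : ∀ j, 0 < c j)
    (hrN : ∑ i, r i = N) (hcN : ∑ j, c j = N)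
    (hrne : ¬ ∀ i i', r i = r i') (hcne : ¬ ∀ j j', c j = c j') :
    ∃ γ : ℝ, 1 < γ ∧ ∃ K : ℕ, ∀ k ≥ K,
      ((Nat.card {D : Matrix (Fin (k * m)) (Fin (k * n)) ℕ //
          (∀ i, ∑ j, D i j = k * r ⟨i.val / k, Nat.div_lt_of_lt_mul i.isLt⟩) ∧
          (∀ j, ∑ i, D i j = k * c ⟨j.val / k, Nat.div_lt_of_lt_mul j.isLt⟩)} : ℝ) /
          (Nat.choose (k ^ 2 * N + k ^ 2 * (m * n) - 1) (k ^ 2 * (m * n) - 1) : ℝ)) /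
        (((∏ i, (Nat.choose (k * r i + k * n - 1) (k * n - 1) : ℝ) ^ k) /
            (Nat.choose (k ^ 2 * N + k ^ 2 * (m * n) - 1) (k ^ 2 * (m * n) - 1) : ℝ)) *
          ((∏ j, (Nat.choose (k * c j + k * m - 1) (k * m - 1) : ℝ) ^ k) /
            (Nat.choose (k ^ 2 * N + k ^ 2 * (m * n) - 1) (k ^ 2 * (m * n) - 1) : ℝ))) ≥
        γ ^ (k ^ 2) := by
  have hN : 0 < N := hrN ▸ Finset.sum_pos (fun i _ => hr i) ⟨⟨0, by lia⟩, Finset.mem_univ _⟩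
  have hgap := geometricEntropy_product_gt (p := fun i => (r i : ℝ)) (q := fun j => (c j : ℝ))
    (S := N) (fun i => by exact_mod_cast hr i) (fun j => by exact_mod_cast hc j)
    (by exact_mod_cast hrN) (by exact_mod_cast hcN) (by exact_mod_cast hrne)
    (by exact_mod_cast hcne)
  simp only [Fintype.card_fin] at hgap
  obtain ⟨P, hPr, hPc⟩ := contingencyTables_nonempty r c (hrN.trans hcN.symm)
  let w (k : ℕ) (i : Fin m) (j : Fin n) : ℕ := k ^ 2 / N * (r i * c j) + k ^ 2 % N * P i j
  have hdm (k : ℕ) : k ^ 2 / N * N + k ^ 2 % N = k ^ 2 := by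
    rw [mul_comm]; exact Nat.div_add_mod _ _
  have hwr (k) (i) : ∑ j, w k i j = k ^ 2 * r i := by
    simp only [w, Finset.sum_add_distrib, ← Finset.mul_sum, hPr, hcN]
    nth_rewrite 3 [← hdm k]
    ring
  have hwc (k) (j) : ∑ i, w k i j = k ^ 2 * c j := by
    simp only [w, Finset.sum_add_distrib, ← Finset.mul_sum, ← Finset.sum_mul, hPc, hrN]
    nth_rewrite 3 [← hdm k]
    ring
  set H : ℝ := n * ∑ i, geometricEntropy (r i / n) + m * ∑ j, geometricEntropy (c j / m) with hH
  set G : ℝ := m * n * geometricEntropy (N / (m * n)) with hG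
  let F (k : ℕ) : ℝ := ∑ i, ∑ j, geometricEntropy (w k i j / (k : ℝ) ^ 2) + G - H -
    (((m * n + 1 : ℕ) : ℝ) * (2 + 3 * Real.log ((k : ℝ) ^ 2 * (N + m * n : ℕ) + 1)) +
      k * (m + n : ℕ) * Real.log ((k : ℝ) ^ 2 * (N + m * n : ℕ) + 1)) / (k : ℝ) ^ 2
  have hF : Filter.Tendsto F Filter.atTop
      (nhds (∑ i, ∑ j, geometricEntropy (r i * c j / N) + G - H)) := by
    rw [← sub_zero (_ + G - H)]
    refine Filter.Tendsto.sub (Filter.Tendsto.sub_const (Filter.Tendsto.add_const _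
      (tendsto_finsetSum _ fun i _ => tendsto_finsetSum _ fun j _ => ?_)) _)
      (tendsto_error_div_sq _ _ _)
    refine (continuous_geometricEntropy.tendsto _).comp ?_
    rw [← Nat.cast_mul]
    exact tendsto_rounding_div_sq hN (r i * c j) (P i j)
  set Δ : ℝ := ∑ i, ∑ j, geometricEntropy (r i * c j / N) + G - H
  have hΔ : 0 < Δ := by simp only [Δ]; linarith
  refine ⟨Real.exp (Δ / 2), Real.one_lt_exp_iff.2 (half_pos hΔ), ?_⟩
  obtain ⟨K, hK⟩ := Filter.eventually_atTop.1 (hF.eventually_const_lt (half_lt_self hΔ))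
  refine ⟨max K 1, fun k hk => ?_⟩
  have hk0 : 0 < k := (le_max_right _ _).trans hk
  have hkF := hK k ((le_max_left _ _).trans hk)
  rw [card_cloned_eq_ncard m n k (fun i => k * r i) (fun j => k * c j)]
  obtain ⟨hTpos, hT⟩ := le_log_ncard_contingencyTables hk0 (w k) r c (hwr k) (hwc k) hrN
  set T := (contingencyTables (fun x : Fin m × Fin k => k * r x.1)
        (fun y : Fin n × Fin k => k * c y.1)).ncard
  have hmn : 0 < m * n := by positivity
  have hb : 0 < k ^ 2 * (m * n) := by positivity
  have hB := le_log_choose (k ^ 2 * N) hb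
  have hR := log_prod_choose_le r hk0 (d := n) (by lia)
  have hC := log_prod_choose_le c hk0 (d := m) (by lia)
  have hBpos : (0 : ℝ) <
      Nat.choose (k ^ 2 * N + k ^ 2 * (m * n) - 1) (k ^ 2 * (m * n) - 1) := by
    exact_mod_cast Nat.choose_pos (by lia)
  have hRpos : (0 : ℝ) < ∏ i, (Nat.choose (k * r i + k * n - 1) (k * n - 1) : ℝ) ^ k :=
    Finset.prod_pos fun i _ => pow_pos (by exact_mod_cast Nat.choose_pos (by lia)) k
  have hCpos : (0 : ℝ) < ∏ j, (Nat.choose (k * c j + k * m - 1) (k * m - 1) : ℝ) ^ k :=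
    Finset.prod_pos fun j _ => pow_pos (by exact_mod_cast Nat.choose_pos (by lia)) k
  have hTpos' : (0 : ℝ) < T := by exact_mod_cast hTpos
  set B : ℝ := (Nat.choose (k ^ 2 * N + k ^ 2 * (m * n) - 1) (k ^ 2 * (m * n) - 1) : ℝ)
  set X : ℝ := ∏ i, (Nat.choose (k * r i + k * n - 1) (k * n - 1) : ℝ) ^ k
  set Y : ℝ := ∏ j, (Nat.choose (k * c j + k * m - 1) (k * m - 1) : ℝ) ^ k
  have hk2 : (0 : ℝ) < (k : ℝ) ^ 2 := by positivity
  rw [show (T : ℝ) / B / (X / B * (Y / B)) = T * B / (X * Y) by field_simp, ge_iff_le,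
    ← Real.exp_nat_mul, ← Real.le_log_iff_exp_le (by positivity),
    Real.log_div (by positivity) (by positivity), Real.log_mul (by positivity) (by positivity),
    Real.log_mul (by positivity) (by positivity)]
  push_cast at hB
  rw [mul_div_mul_left _ _ hk2.ne', ← mul_add] at hB
  have hL : Real.log ((k : ℝ) ^ 2 * (N + 1 : ℕ) + 1) ≤
      Real.log ((k : ℝ) ^ 2 * (N + m * n : ℕ) + 1) := by
    refine Real.log_le_log (by positivity) ?_
    gcongr
    exact hmn
  have hQ : (((N + m * n : ℕ)) : ℝ) = (N + m * n : ℝ) := by push_cast; ring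
  rw [← hQ] at hB
  have hkF' := mul_lt_mul_of_pos_left hkF hk2
  simp only [F] at hkF'
  rw [mul_sub, mul_div_cancel₀ _ hk2.ne'] at hkF'
  have h1 := mul_le_mul_of_nonneg_left hL (show (0 : ℝ) ≤ m * n * 3 by positivity)
  have h2 := mul_le_mul_of_nonneg_left hL (show (0 : ℝ) ≤ k * (m + n : ℕ) by positivity)
  generalize Real.log ((k : ℝ) ^ 2 * (N + m * n : ℕ) + 1) = L at *
  generalize Real.log ((k : ℝ) ^ 2 * (N + 1 : ℕ) + 1) = L' at *
  rw [hH, hG] at hkF'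
  push_cast at hkF' hT h1 h2 ⊢
  linarith
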